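/- arXiv:2012.03813 — 4 statements merged into one kernel-verified Lean document; each statement's English description precedes it below -/
import Mathlib

section
/- Let n ≥ 1 and let S be a set of unordered pairs of elements of {1,…,n} (i.e., a simple graph on the vertex set {1,…,n}). Then the absolute value of the sum, over all connected simple graphs G on the full vertex set {1,…,n} all of whose edges lie in S, of (−1)^{number of edges of G}, is at most the number of spanning trees T on {1,…,n} all of whose edges lie in S. (This is the Penrose tree-graph inequality for hard-core cluster coefficients, used in equation (3.9) of the paper.) -/
open scoped Classical

/-- Adding an edge between two already joined vertices does not affect connectedness. -/
theorem connected_fromEdgeSet_insert_iff {V : Type*} {s t : Set (Sym2 V)} {u v : V}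
    (hst : s ⊆ t) (h : (SimpleGraph.fromEdgeSet s).Reachable u v) :
    (SimpleGraph.fromEdgeSet (insert s(u, v) t)).Connected ↔
      (SimpleGraph.fromEdgeSet t).Connected := by
  refine ⟨fun hc => ?_, fun hc => hc.mono (SimpleGraph.fromEdgeSet_mono (Set.subset_insert _ _))⟩
  have huv : (SimpleGraph.fromEdgeSet t).Reachable u v :=
    h.mono (SimpleGraph.fromEdgeSet_mono hst)
  have := hc.nonempty
  refine SimpleGraph.Connected.mk fun a b => ?_
  obtain ⟨p⟩ := hc.preconnected a b
  induction p with
  | nil => rfl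
  | cons hadj _ ih =>
    refine SimpleGraph.Reachable.trans ?_ ih
    rw [SimpleGraph.fromEdgeSet_adj, Set.mem_insert_iff] at hadj
    obtain ⟨he | he, hne⟩ := hadj
    · rcases Sym2.eq_iff.1 he with ⟨rfl, rfl⟩ | ⟨rfl, rfl⟩
      · exact huv
      · exact huv.symm
    · exact SimpleGraph.Adj.reachable ((SimpleGraph.fromEdgeSet_adj _).2 ⟨he, hne⟩)

/-- Adding an edge between two distinct components of a forest gives a forest. -/
theorem isAcyclic_fromEdgeSet_insert {V : Type*} {s : Set (Sym2 V)} {u v : V}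
    (hs : (SimpleGraph.fromEdgeSet s).IsAcyclic)
    (h : ¬ (SimpleGraph.fromEdgeSet s).Reachable u v) :
    (SimpleGraph.fromEdgeSet (insert s(u, v) s)).IsAcyclic := by
  have := hs.sup_edge_of_not_reachable h
  rwa [SimpleGraph.edge, ← SimpleGraph.fromEdgeSet_union, Set.union_singleton] at this

/-- The tree-graph inequality relative to a forest `F` of edges that are always present. -/
theorem abs_sum_connected_union_le {n : ℕ} (U F : Finset (Sym2 (Fin n)))
    (hU : ∀ e ∈ U, ¬ e.IsDiag) (hF : ∀ e ∈ F, ¬ e.IsDiag)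
    (hac : (SimpleGraph.fromEdgeSet (F : Set (Sym2 (Fin n)))).IsAcyclic) :
    |∑ A ∈ U.powerset,
        if (SimpleGraph.fromEdgeSet (↑(F ∪ A) : Set (Sym2 (Fin n)))).Connected
        then (-1 : ℤ) ^ A.card else 0|
      ≤ ∑ A ∈ U.powerset,
        if (SimpleGraph.fromEdgeSet (↑(F ∪ A) : Set (Sym2 (Fin n)))).Connected ∧
          (F ∪ A).card = n - 1 then (1 : ℤ) else 0 := by
  induction U using Finset.induction_on generalizing F with
  | empty =>
    simp only [Finset.powerset_empty, Finset.sum_singleton, Finset.union_empty,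
      Finset.card_empty, pow_zero]
    by_cases hc : (SimpleGraph.fromEdgeSet (F : Set (Sym2 (Fin n)))).Connected
    · have hcard := SimpleGraph.IsTree.card_edgeFinset ⟨hc, hac⟩
      have hFe : (SimpleGraph.fromEdgeSet (F : Set (Sym2 (Fin n)))).edgeFinset = F := by
        ext e
        simpa using hF e
      rw [hFe, Fintype.card_fin] at hcard
      have : F.card = n - 1 := by omega
      simp [hc, this]
    · simp [hc]
  | insert e U he ih =>
    have hU' : ∀ e ∈ U, ¬ e.IsDiag := fun x hx => hU x (Finset.mem_insert_of_mem hx)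
    have hcard : ∀ A ∈ U.powerset, (insert e A).card = A.card + 1 := fun A hA =>
      Finset.card_insert_of_notMem fun h => he (Finset.mem_powerset.1 hA h)
    rw [Finset.sum_powerset_insert he, Finset.sum_powerset_insert he]
    induction e with | _ u v
    by_cases hr : (SimpleGraph.fromEdgeSet (F : Set (Sym2 (Fin n)))).Reachable u v
    · rw [← Finset.sum_add_distrib, Finset.sum_eq_zero, abs_zero]
      · exact add_nonneg (Finset.sum_nonneg fun _ _ => by split_ifs <;> simp)
          (Finset.sum_nonneg fun _ _ => by split_ifs <;> simp)
      · intro A hA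
        rw [hcard A hA]
        simp only [Finset.union_insert, Finset.coe_insert, connected_fromEdgeSet_insert_iff
          (Finset.coe_subset.2 Finset.subset_union_left) hr]
        split_ifs <;> ring
    · have hF' : ∀ x ∈ insert s(u, v) F, ¬ x.IsDiag := by
        intro x hx
        rcases Finset.mem_insert.1 hx with rfl | hx
        · exact hU _ (Finset.mem_insert_self _ _)
        · exact hF x hx
      have hdel := ih F hU' hF hac
      have hcon := ih (insert s(u, v) F) hU' hF' (by
        rw [Finset.coe_insert]
        exact isAcyclic_fromEdgeSet_insert hac hr)
      refine (abs_add_le _ _).trans (add_le_add hdel ?_)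
      simp only [Finset.insert_union, ← Finset.union_insert] at hcon
      refine le_trans (le_of_eq ?_) hcon
      rw [← abs_neg, ← Finset.sum_neg_distrib]
      refine congrArg _ (Finset.sum_congr rfl fun A hA => ?_)
      rw [hcard A hA]
      split_ifs <;> ring

/-- Penrose tree-graph inequality: for a simple graph `S` on `{1,…,n}` (given by its
edge set, a finite set of non-diagonal unordered pairs), the absolute value of the sum
over all connected graphs `G` on the full vertex set with edge set contained in `S` of
`(−1)^{#edges of G}` is at most the number of spanning trees (connected graphs with
`n − 1` edges) with edges in `S`. -/
theorem stmt_0 (n : ℕ) (hn : 1 ≤ n) (S : Finset (Sym2 (Fin n)))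
    (hS : ∀ e ∈ S, ¬ e.IsDiag) :
    |∑ E ∈ S.powerset.filter
          (fun E : Finset (Sym2 (Fin n)) =>
            (SimpleGraph.fromEdgeSet (↑E : Set (Sym2 (Fin n)))).Connected),
        (-1 : ℤ) ^ E.card|
      ≤ ((S.powerset.filter fun E : Finset (Sym2 (Fin n)) =>
            (SimpleGraph.fromEdgeSet (↑E : Set (Sym2 (Fin n)))).Connected ∧
              E.card = n - 1).card : ℤ) := by
  have h := abs_sum_connected_union_le S ∅ hS (by simp) (by simp)
  simp only [Finset.empty_union] at h
  rw [Finset.sum_filter, Finset.card_filter]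
  push_cast
  exact h
end

section
/- Let E be a type, let N ≥ 1 and M ≥ 0 be integers, let z_1,…,z_M be elements of E, and let Φ : E^N → ℝ be a symmetric function (invariant under all permutations of its N arguments). Then ( ∑_{(i_1,…,i_N)} Φ(z_{i_1},…,z_{i_N}) )² = ∑_{ℓ=0}^{N} \binom{N}{ℓ}² · ℓ! · ∑_{(i_1,…,i_{2N−ℓ})} Φ(z_{i_1},…,z_{i_N}) · Φ(z_{i_1},…,z_{i_ℓ}, z_{i_{N+1}},…,z_{i_{2N−ℓ}}), where each sum ∑_{(i_1,…,i_k)} runs over all k-tuples of pairwise distinct indices in {1,…,M} (empty if k > M). -/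
open Finset in
/-- The number of embeddings that carry the colouring `p` to the colouring `q`. -/
theorem Fintype.card_embedding_colouring {ι γ κ : Type*} [Fintype ι] [Fintype γ] [Fintype κ]
    [DecidableEq ι] [DecidableEq γ] [DecidableEq κ] (p : ι → κ) (q : γ → κ) :
    Fintype.card {g : ι ↪ γ // ∀ i, q (g i) = p i} =
      ∏ k, (Fintype.card {x // q x = k}).descFactorial (Fintype.card {i // p i = k}) := by
  let e : {g : ι ↪ γ // ∀ i, q (g i) = p i} ≃ ∀ k, {i // p i = k} ↪ {x // q x = k} :=
    { toFun := fun g k =>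
        ⟨fun i => ⟨g.1 i, (g.2 i).trans i.2⟩, fun i j h =>
          Subtype.ext (g.1.injective (congrArg Subtype.val h))⟩
      invFun := fun e =>
        ⟨⟨fun i => (e (p i) ⟨i, rfl⟩).1, fun i j h => by
            have key : ∀ k l (a : {i // p i = k}) (b : {i // p i = l}), k = l →
                (e k a).1 = (e l b).1 → a.1 = b.1 := by
              rintro k _ a b rfl hab
              exact congrArg Subtype.val ((e k).injective (Subtype.ext hab))
            refine key _ _ ⟨i, rfl⟩ ⟨j, rfl⟩ ?_ h
            have hi := (e (p i) ⟨i, rfl⟩).2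
            have hj := (e (p j) ⟨j, rfl⟩).2
            exact hi.symm.trans ((congrArg q h).trans hj)⟩,
          fun i => (e (p i) ⟨i, rfl⟩).2⟩
      left_inv := fun g => rfl
      right_inv := fun e => by
        funext k
        ext ⟨i, rfl⟩
        rfl }
  rw [Fintype.card_congr e, Fintype.card_pi]
  exact Finset.prod_congr rfl fun k _ => Fintype.card_embedding_eq

open Finset Nat in
/-- The number of embeddings carrying a covering pair `A`, `B` to a pair `S`, `T` of the same
cardinalities. -/
theorem Finset.card_filter_map_eq_and_map_eq {ι γ : Type*} [Fintype ι] [Fintype γ]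
    [DecidableEq ι] [DecidableEq γ] {A B : Finset ι} {S T : Finset γ} (hAB : A ∪ B = univ)
    (hS : #S = #A) (hT : #T = #B) (hST : #(S ∩ T) = #(A ∩ B)) :
    #{g : ι ↪ γ | A.map g = S ∧ B.map g = T} = (#(A ∩ B))! * (#(A \ B))! * (#(B \ A))! := by
  have hmap : ∀ g : ι ↪ γ, (A.map g = S ∧ B.map g = T) ↔
      ∀ i, (decide (g i ∈ S), decide (g i ∈ T)) = (decide (i ∈ A), decide (i ∈ B)) := by
    intro g
    constructor
    · rintro ⟨rfl, rfl⟩ i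
      simp
    · intro h
      simp only [Prod.mk.injEq, decide_eq_decide] at h
      constructor
      · refine eq_of_subset_of_card_le ?_ (by simp [hS])
        simp only [subset_iff, mem_map]
        rintro _ ⟨i, hi, rfl⟩
        exact (h i).1.2 hi
      · refine eq_of_subset_of_card_le ?_ (by simp [hT])
        simp only [subset_iff, mem_map]
        rintro _ ⟨i, hi, rfl⟩
        exact (h i).2.2 hi
  simp_rw [hmap]
  rw [← Fintype.card_subtype, Fintype.card_embedding_colouring
    (fun i => (decide (i ∈ A), decide (i ∈ B))) (fun x => (decide (x ∈ S), decide (x ∈ T)))]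
  have h0 : #{i | i ∉ A ∧ i ∉ B} = 0 := by
    rw [card_eq_zero, filter_eq_empty_iff]
    intro i _
    have := mem_univ i
    rw [← hAB, mem_union] at this
    tauto
  have e1 : ({i | i ∈ A ∧ i ∈ B} : Finset ι) = A ∩ B := by ext; simp
  have e2 : ({i | i ∈ A ∧ i ∉ B} : Finset ι) = A \ B := by ext; simp
  have e3 : ({i | i ∉ A ∧ i ∈ B} : Finset ι) = B \ A := by ext; simp [and_comm]
  have e4 : ({x | x ∈ S ∧ x ∈ T} : Finset γ) = S ∩ T := by ext; simp
  have e5 : ({x | x ∈ S ∧ x ∉ T} : Finset γ) = S \ T := by ext; simp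
  have e6 : ({x | x ∉ S ∧ x ∈ T} : Finset γ) = T \ S := by ext; simp [and_comm]
  have c1 : #(S \ T) = #(A \ B) := by
    rw [card_sdiff, card_sdiff, inter_comm T, inter_comm B, hS, hST]
  have c2 : #(T \ S) = #(B \ A) := by
    rw [card_sdiff, card_sdiff, hT, hST]
  simp only [Fintype.card_subtype, Fintype.prod_prod_type, Fintype.prod_bool, Prod.mk.injEq,
    decide_eq_true_eq, decide_eq_false_iff_not, h0, e1, e2, e3, e4, e5, e6, c1, c2, hST,
    Nat.descFactorial_self, Nat.descFactorial_zero, mul_one, mul_assoc]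

open Finset in
/-- A symmetric function of an injective tuple depends only on the set of its entries. -/
theorem exists_finset_function_of_symmetric {E γ : Type*} [DecidableEq γ] {N : ℕ} (z : γ → E)
    (Φ : (Fin N → E) → ℝ)
    (hsym : ∀ σ : Equiv.Perm (Fin N), ∀ y : Fin N → E, Φ (y ∘ σ) = Φ y) :
    ∃ φ : Finset γ → ℝ, (∀ f : Fin N ↪ γ, Φ (z ∘ f) = φ (univ.map f)) ∧
      ∀ S, #S ≠ N → φ S = 0 := by
  classical
  refine ⟨fun S => if h : #S = N then Φ fun i => z ((S.equivFinOfCardEq h).symm i) else 0,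
    fun f => ?_, fun S hS => dif_neg hS⟩
  have hc : #(univ.map f) = N := by simp
  refine Eq.trans ?_ (dif_pos hc).symm
  set e := (univ.map f).equivFinOfCardEq hc
  let σ : Fin N → Fin N := fun i => e ⟨f i, by simp⟩
  have hσ : Function.Injective σ := fun i j h => by
    simpa [σ] using h
  refine Eq.trans ?_ (hsym (Equiv.ofBijective σ (Finite.injective_iff_bijective.1 hσ)) _)
  congr 1
  funext i
  simp [σ]

open Finset in
theorem Finset.sum_map_mul_map {ι γ : Type*} [Fintype ι] [Fintype γ] [DecidableEq ι]
    [DecidableEq γ] (A B : Finset ι) (F : Finset γ → ℝ) :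
    ∑ g : ι ↪ γ, F (A.map g) * F (B.map g) =
      ∑ S, ∑ T, (#{g : ι ↪ γ | A.map g = S ∧ B.map g = T} : ℝ) * (F S * F T) := by
  rw [← Fintype.sum_prod_type',
    ← Finset.sum_fiberwise univ (fun g : ι ↪ γ => (A.map g, B.map g))]
  refine sum_congr rfl fun ⟨S, T⟩ _ => ?_
  simp only [Prod.mk.injEq]
  rw [← nsmul_eq_mul, ← sum_const]
  refine sum_congr rfl fun g hg => ?_
  obtain ⟨rfl, rfl⟩ := (mem_filter.1 hg).2
  rfl

open Finset Nat in
theorem Finset.sum_embedding_map {γ : Type*} [Fintype γ] [DecidableEq γ] {N : ℕ}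
    (F : Finset γ → ℝ) (hF : ∀ S, #S ≠ N → F S = 0) :
    ∑ f : Fin N ↪ γ, F (univ.map f) = N ! * ∑ S, F S := by
  rw [← Finset.sum_fiberwise univ (fun f : Fin N ↪ γ => univ.map f), mul_sum]
  refine sum_congr rfl fun S _ => ?_
  by_cases hS : #S = N
  · have hcard : #{f : Fin N ↪ γ | univ.map f = S} = N ! := by
      have := card_filter_map_eq_and_map_eq (A := (univ : Finset (Fin N))) (B := univ)
        (S := S) (T := S) (by simp) (by simpa) (by simpa) (by simpa)
      simpa using this
    rw [← hcard, ← nsmul_eq_mul, ← sum_const]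
    exact sum_congr rfl fun f hf => congrArg F (mem_filter.1 hf).2
  · rw [hF S hS, mul_zero]
    exact sum_eq_zero fun f hf => by rw [(mem_filter.1 hf).2, hF S hS]

open Finset Nat in
/-- The sum over embeddings of a covering pair of `N`-sets sharing `ℓ` points. -/
theorem Finset.choose_sq_mul_sum_map_mul_map {ι γ : Type*} [Fintype ι] [Fintype γ]
    [DecidableEq ι] [DecidableEq γ] {N ℓ : ℕ} (hℓ : ℓ ≤ N) {A B : Finset ι}
    (hAB : A ∪ B = univ) (hA : #A = N) (hB : #B = N) (hι : Fintype.card ι = 2 * N - ℓ)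
    (F : Finset γ → ℝ) (hF : ∀ S, #S ≠ N → F S = 0) :
    (N.choose ℓ : ℝ) ^ 2 * (ℓ ! : ℝ) * ∑ g : ι ↪ γ, F (A.map g) * F (B.map g) =
      (N ! : ℝ) ^ 2 * ∑ S, ∑ T, if #(S ∩ T) = ℓ then F S * F T else 0 := by
  have hI : #(A ∩ B) = ℓ := by
    have := card_union_add_card_inter A B
    rw [hAB, card_univ] at this
    omega
  have hN : (N.choose ℓ : ℝ) * ℓ ! * (N - ℓ)! = N ! := by
    exact_mod_cast Nat.choose_mul_factorial_mul_factorial hℓ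
  rw [sum_map_mul_map, mul_sum, mul_sum]
  refine sum_congr rfl fun S _ => ?_
  rw [mul_sum, mul_sum]
  refine sum_congr rfl fun T _ => ?_
  by_cases hS : #S = N
  swap
  · simp [hF S hS]
  by_cases hT : #T = N
  swap
  · simp [hF T hT]
  split_ifs with hST
  · rw [card_filter_map_eq_and_map_eq hAB (hS.trans hA.symm) (hT.trans hB.symm)
      (hST.trans hI.symm), card_sdiff, card_sdiff, inter_comm B, hI, hA, hB, ← hN]
    push_cast
    ring
  · have : #{g : ι ↪ γ | A.map g = S ∧ B.map g = T} = 0 := by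
      rw [card_eq_zero, filter_eq_empty_iff]
      rintro g _ ⟨rfl, rfl⟩
      rw [← map_inter, card_map] at hST
      exact hST hI
    simp [this]

/-- Expansion (3.10) of the square of a U-statistic according to the number `ℓ` of
shared indices: for a symmetric `Φ : E^N → ℝ` and points `z_1, …, z_M`,
`(∑_{(i_1,…,i_N)} Φ(z_{i_1},…,z_{i_N}))² = ∑_{ℓ=0}^N (N choose ℓ)² ℓ!
∑_{(i_1,…,i_{2N−ℓ})} Φ(z_{i_1},…,z_{i_N}) Φ(z_{i_1},…,z_{i_ℓ},z_{i_{N+1}},…,z_{i_{2N−ℓ}})`,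
the sums running over tuples of pairwise distinct indices (i.e. over embeddings). -/
theorem stmt_2 (E : Type*) (N M : ℕ) (hN : 1 ≤ N) (z : Fin M → E)
    (Φ : (Fin N → E) → ℝ)
    (hsym : ∀ σ : Equiv.Perm (Fin N), ∀ y : Fin N → E, Φ (y ∘ σ) = Φ y) :
    (∑ f : Fin N ↪ Fin M, Φ (z ∘ f)) ^ 2 =
      ∑ ℓ : Fin (N + 1),
        (N.choose ℓ : ℝ) ^ 2 * ((ℓ : ℕ).factorial : ℝ) *
          ∑ g : Fin (2 * N - (ℓ : ℕ)) ↪ Fin M,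
            Φ (fun i => z (g (Fin.castLE (by have := ℓ.isLt; omega) i))) *
            Φ (fun i => z (g ⟨if (i : ℕ) < (ℓ : ℕ) then (i : ℕ) else (i : ℕ) + (N - (ℓ : ℕ)),
                by have := i.isLt; have := ℓ.isLt; split <;> omega⟩)) := by
  classical
  obtain ⟨φ, hΦ, hφ⟩ := exists_finset_function_of_symmetric z Φ hsym
  trans ∑ ℓ : Fin (N + 1), (N.factorial : ℝ) ^ 2 *
      ∑ S, ∑ T, if (S ∩ T).card = (ℓ : ℕ) then φ S * φ T else 0
  · rw [← Finset.mul_sum, Finset.sum_congr rfl fun f _ => hΦ f, Finset.sum_embedding_map φ hφ,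
      mul_pow]
    congr 1
    rw [sq, Finset.sum_mul_sum]
    conv_rhs => rw [Finset.sum_comm]
    refine Finset.sum_congr rfl fun S _ => ?_
    conv_rhs => rw [Finset.sum_comm]
    refine Finset.sum_congr rfl fun T _ => ?_
    by_cases hS : S.card = N
    · have hlt : (S ∩ T).card < N + 1 :=
        Nat.lt_succ_iff.2 (hS ▸ Finset.card_le_card Finset.inter_subset_left)
      rw [Finset.sum_eq_single ⟨_, hlt⟩ (fun ℓ _ hℓ => if_neg fun h => hℓ (Fin.ext h.symm))
        (by simp)]
      simp
    · simp [hφ S hS]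
  · refine Finset.sum_congr rfl fun ℓ _ => ?_
    have hℓ : (ℓ : ℕ) ≤ N := Nat.lt_succ_iff.1 ℓ.isLt
    let u : Fin N ↪ Fin (2 * N - (ℓ : ℕ)) := Fin.castLEEmb (by omega)
    let v : Fin N ↪ Fin (2 * N - (ℓ : ℕ)) :=
      ⟨fun i => ⟨if (i : ℕ) < (ℓ : ℕ) then (i : ℕ) else (i : ℕ) + (N - (ℓ : ℕ)),
        by have := i.isLt; split <;> omega⟩, fun i j h => by
          simp only [Fin.mk.injEq] at h
          ext
          split_ifs at h <;> omega⟩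
    have huv : Finset.univ.map u ∪ Finset.univ.map v = Finset.univ := by
      refine Finset.eq_univ_of_forall fun i => ?_
      have hi := i.isLt
      simp only [Finset.mem_union, Finset.mem_map, Finset.mem_univ, true_and]
      by_cases h : (i : ℕ) < N
      · exact Or.inl ⟨⟨i, h⟩, rfl⟩
      · refine Or.inr ⟨⟨i - (N - ℓ), by omega⟩, ?_⟩
        ext
        change (if (i : ℕ) - (N - ℓ) < (ℓ : ℕ) then (i : ℕ) - (N - ℓ)
          else (i : ℕ) - (N - ℓ) + (N - ℓ)) = (i : ℕ)
        split_ifs <;> omega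
    rw [← Finset.choose_sq_mul_sum_map_mul_map hℓ huv (by simp) (by simp) (by simp) φ hφ]
    congr 1
    refine Finset.sum_congr rfl fun g _ => ?_
    rw [Finset.map_map, Finset.map_map, ← hΦ, ← hΦ]
    rfl
end

section
/- Let d ≥ 1, n ≥ 2 and r > 0. The Lebesgue (Haar) measure of the set of n-tuples (x_1,…,x_n) ∈ (𝕋^d)^n such that the graph on {1,…,n} with an edge between i and j whenever dist_{𝕋^d}(x_i, x_j) ≤ r is connected, is at most n^{n−2} · (ω_d r^d)^{n−1}, where ω_d is the Lebesgue volume of the unit ball of ℝ^d. -/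
open MeasureTheory

/-- The parent maps of forests on `S` rooted at `R`, extended by the identity off `S \ R`. -/
noncomputable def forestMaps {V : Type*} [Fintype V] [DecidableEq V] (S R : Finset V) :
    Finset (V → V) := by
  classical
  exact {p | (∀ v ∈ S \ R, p v ∈ S) ∧ (∀ v ∉ S \ R, p v = v) ∧
    ∃ h : V → ℕ, ∀ v ∈ S \ R, h (p v) < h v}

lemma mem_forestMaps {V : Type*} [Fintype V] [DecidableEq V] {S R : Finset V} {p : V → V} :
    p ∈ forestMaps S R ↔ (∀ v ∈ S \ R, p v ∈ S) ∧ (∀ v ∉ S \ R, p v = v) ∧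
      ∃ h : V → ℕ, ∀ v ∈ S \ R, h (p v) < h v := by
  simp [forestMaps]

lemma card_forestMaps_le_sum {V : Type*} [Fintype V] [DecidableEq V] (S R : Finset V) :
    (forestMaps S R).card ≤
      ∑ J ∈ (S \ R).powerset, R.card ^ J.card * (forestMaps (S \ R) J).card := by
  classical
  rw [Finset.card_eq_sum_card_fiberwise (f := fun p : V → V => {v ∈ S \ R | p v ∈ R})
    (t := (S \ R).powerset) (fun p _ => by simp only [Finset.mem_coe,
      Finset.mem_powerset, Finset.filter_subset])]
  refine Finset.sum_le_sum fun J hJ => ?_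
  have hcard : (Fintype.piFinset fun v => if v ∈ J then R else {v}).card = R.card ^ J.card := by
    rw [Fintype.card_piFinset, ← Finset.prod_const,
      ← Finset.prod_subset (Finset.subset_univ J) (fun v _ hv => by simp [hv])]
    exact Finset.prod_congr rfl fun v hv => by simp [hv]
  rw [← hcard, ← Finset.card_product]
  refine Finset.card_le_card_of_injOn
    (fun p => (fun v => if v ∈ J then p v else v, fun v => if v ∈ J then v else p v)) ?_ ?_
  · intro p hp
    simp only [Finset.coe_filter, Set.mem_ofPred_eq, mem_forestMaps] at hp
    obtain ⟨⟨hS, hid, h, hh⟩, rfl⟩ := hp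
    simp only [Finset.coe_product, Set.mem_prod, Finset.mem_coe, Fintype.mem_piFinset,
      mem_forestMaps]
    refine ⟨fun v => ?_, fun v hv => ?_, fun v hv => ?_, h, fun v hv => ?_⟩
    · split_ifs with hv
      · exact (Finset.mem_filter.1 hv).2
      · simp
    · grind
    · grind
    · grind
  · intro p _ q _ hpq
    funext v
    have h1 := congrFun (congrArg Prod.fst hpq) v
    have h2 := congrFun (congrArg Prod.snd hpq) v
    by_cases hv : v ∈ J 
    · simpa [hv] using h1
    · simpa [hv] using h2

lemma sum_powerset_card_mul_pow {V : Type*} (T : Finset V) (a b : ℕ) :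
    ∑ J ∈ T.powerset, a ^ J.card * (J.card * b ^ (T.card - J.card)) =
      T.card * a * (a + b) ^ (T.card - 1) := by
  rw [Finset.sum_powerset_apply_card (fun j => a ^ j * (j * b ^ (T.card - j)))]
  rcases T.card with _ | m
  · simp
  rw [Finset.sum_range_succ', add_tsub_cancel_right, add_pow, Finset.mul_sum]
  simp only [zero_mul, mul_zero, add_zero, smul_eq_mul]
  refine Finset.sum_congr rfl fun j _ => ?_
  have := Nat.add_one_mul_choose_eq m j
  rw [Nat.add_sub_add_right, pow_succ]
  simp only [Nat.cast_id]
  linear_combination (a ^ j * a * b ^ (m - j)) * this.symm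

/-- The upper bound in Cayley's formula for rooted forests. -/
lemma card_forestMaps_mul_card_le {V : Type*} [Fintype V] [DecidableEq V] {S R : Finset V}
    (hRS : R ⊆ S) :
    (forestMaps S R).card * S.card ≤ R.card * S.card ^ (S.card - R.card) := by
  induction hN : S.card using Nat.strong_induction_on generalizing S R with
  | _ N ih =>
  subst hN
  rcases R.eq_empty_or_nonempty with rfl | hR
  · rcases S.eq_empty_or_nonempty with rfl | hS
    · simp
    · have : forestMaps S ∅ = ∅ := by
        refine Finset.eq_empty_of_forall_notMem fun p hp => ?_
        obtain ⟨h1, -, h, hh⟩ := mem_forestMaps.1 hp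
        obtain ⟨v, hv, hmin⟩ := Finset.exists_min_image S h hS
        exact absurd (hmin _ (h1 v (by simpa using hv))) (hh v (by simpa using hv)).not_ge
      simp [this]
  have hm : (S \ R).card = S.card - R.card := Finset.card_sdiff_of_subset hRS
  have hle := Finset.card_le_card hRS
  have hpos := hR.card_pos
  rcases hRS.eq_or_ssubset with rfl | hlt
  · have : forestMaps R R ⊆ {id} := fun p hp => by
      obtain ⟨-, h, -⟩ := mem_forestMaps.1 hp
      simp only [Finset.mem_singleton]
      exact funext fun v => h v (by simp)
    have := Finset.card_le_card this
    simp only [Finset.card_singleton] at this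
    simpa using Nat.mul_le_mul_right R.card this
  have hlt' := Finset.card_lt_card hlt
  have key : (forestMaps S R).card * (S \ R).card ≤
      (S \ R).card * R.card * (R.card + (S \ R).card) ^ ((S \ R).card - 1) := by
    rw [← sum_powerset_card_mul_pow]
    refine (Nat.mul_le_mul_right _ (card_forestMaps_le_sum S R)).trans ?_
    rw [Finset.sum_mul]
    refine Finset.sum_le_sum fun J hJ => ?_
    rw [mul_assoc]
    exact Nat.mul_le_mul_left _ (ih _ (by omega) (Finset.mem_powerset.1 hJ) rfl)
  have key' : (forestMaps S R).card ≤ R.card * S.card ^ (S.card - R.card - 1) := by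
    rw [hm, Nat.add_sub_cancel' hle, mul_assoc, mul_comm] at key
    exact Nat.le_of_mul_le_mul_left key (by omega)
  calc _ ≤ R.card * S.card ^ (S.card - R.card - 1) * S.card := Nat.mul_le_mul_right _ key'
    _ = _ := by
      rw [mul_assoc, ← pow_succ]
      congr 2
      omega

lemma SimpleGraph.Connected.exists_mem_forestMaps {V : Type*} [Fintype V] [DecidableEq V]
    {G : SimpleGraph V} (hG : G.Connected) (o : V) :
    ∃ p ∈ forestMaps Finset.univ {o}, ∀ v, v ≠ o → G.Adj v (p v) := by
  have hstep : ∀ v, v ≠ o → ∃ w, G.Adj v w ∧ G.dist w o < G.dist v o := by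
    intro v hv
    obtain ⟨W, hW⟩ := (hG.preconnected v o).exists_walk_length_eq_dist
    cases W with
    | nil => exact absurd rfl hv
    | cons hadj W' =>
      refine ⟨_, hadj, ?_⟩
      have := SimpleGraph.dist_le W'
      rw [SimpleGraph.Walk.length_cons] at hW
      omega
  choose! q hq using hstep
  refine ⟨fun v => if v = o then o else q v, mem_forestMaps.2
    ⟨fun v _ => by simp, fun v hv => ?_, fun v => G.dist v o, fun v hv => ?_⟩, fun v hv => ?_⟩
  · have : v = o := by simpa using hv
    simp [this]
  · have : v ≠ o := by simpa using hv
    simpa [this] using (hq v this).2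
  · simpa [hv] using (hq v hv).1


lemma lmarginal_prod_le {ι E : Type*} [DecidableEq ι] [MeasurableSpace E] {μ : ι → Measure E}
    [∀ i, SigmaFinite (μ i)] (h : ι → ℕ) {g : ι → (ι → E) → ENNReal}
    (hg : ∀ i, Measurable (g i))
    (hdep : ∀ v w, h w ≤ h v → w ≠ v → ∀ x y, g w (Function.update x v y) = g w x)
    {c : ι → ENNReal} (hc : ∀ v x, ∫⁻ y, g v (Function.update x v y) ∂μ v ≤ c v)
    (S : Finset ι) :
    ∫⋯∫⁻_S, (fun x => ∏ v ∈ S, g v x) ∂μ ≤ fun _ => ∏ v ∈ S, c v := by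
  induction S using Finset.induction_on_max_value h with
  | empty => simp
  | insert a s ha hmax ih =>
    rw [lmarginal_insert' _ (Finset.measurable_prod _ fun i _ => hg i) ha]
    have hpt : (fun x => ∫⁻ y, ∏ v ∈ insert a s, g v (Function.update x a y) ∂μ a) ≤
        fun x => c a * ∏ v ∈ s, g v x := fun x => by
      have hs : ∀ y, ∏ v ∈ s, g v (Function.update x a y) = ∏ v ∈ s, g v x := fun y =>
        Finset.prod_congr rfl fun w hw =>
          hdep a w (hmax w hw) (ne_of_mem_of_not_mem hw ha) x y
      simp only [Finset.prod_insert ha, hs]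
      rw [lintegral_mul_const _ (by fun_prop)]
      gcongr
      exact hc a x
    refine (lmarginal_mono hpt).trans fun x => ?_
    have hmeas : Measurable fun y : s → E => ∏ v ∈ s, g v (Function.updateFinset x s y) :=
      Finset.measurable_prod _ fun i _ => (hg i).comp measurable_updateFinset
    rw [Finset.prod_insert ha, lmarginal, lintegral_const_mul _ hmeas]
    gcongr
    exact ih x

lemma volume_unitCube_le_one (d : ℕ) :
    volume {y : EuclideanSpace ℝ (Fin d) | ∀ i, 0 ≤ y i ∧ y i < 1} ≤ 1 := by
  have := (PiLp.volume_preserving_ofLp (Fin d)).measure_preimage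
    (s := Set.univ.pi fun _ => Set.Ico (0 : ℝ) 1)
    (MeasurableSet.univ_pi fun _ => measurableSet_Ico).nullMeasurableSet
  rw [Real.volume_pi_Ico] at this
  simp only [sub_zero, ENNReal.ofReal_one, Finset.prod_const_one] at this
  rw [← this]
  exact measure_mono fun y hy i _ => hy i

lemma measurableSet_unitCube (d : ℕ) :
    MeasurableSet {y : EuclideanSpace ℝ (Fin d) | ∀ i, 0 ≤ y i ∧ y i < 1} := by
  measurability

/-- A ball of the torus has at most the volume of the Euclidean ball of the same radius. -/
lemma volume_torusBall_le (d : ℕ) (z : EuclideanSpace ℝ (Fin d)) {r : ℝ} (hr : 0 ≤ r) :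
    volume {y : EuclideanSpace ℝ (Fin d) | (∀ i, 0 ≤ y i ∧ y i < 1) ∧
      ∃ k : Fin d → ℤ, ‖y - z - WithLp.toLp 2 (fun i => (k i : ℝ))‖ ≤ r} ≤
      volume (Metric.ball (0 : EuclideanSpace ℝ (Fin d)) 1) * ENNReal.ofReal (r ^ d) := by
  let C : (Fin d → ℤ) → Set (EuclideanSpace ℝ (Fin d)) := fun k =>
    {u | (∀ i, 0 ≤ (u + WithLp.toLp 2 fun j => (k j : ℝ)) i ∧
      (u + WithLp.toLp 2 fun j => (k j : ℝ)) i < 1)} ∩ Metric.closedBall z r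
  have hCmeas : ∀ k, MeasurableSet (C k) := fun k =>
    ((measurableSet_unitCube d).preimage (measurable_add_const _)).inter
      Metric.isClosed_closedBall.measurableSet
  have hdisj : Pairwise (Function.onFun Disjoint C) := fun k l hkl =>
    Set.disjoint_left.2 fun u hk hl => hkl <| funext fun i => by
      have h1 := hk.1 i
      have h2 := hl.1 i
      simp only [PiLp.add_apply] at h1 h2
      have h3 : (k i : ℝ) < l i + 1 := by linarith
      have h4 : (l i : ℝ) < k i + 1 := by linarith
      norm_cast at h3 h4
      omega
  calc _ ≤ volume (⋃ k : Fin d → ℤ, (· + -(WithLp.toLp 2 fun i => (k i : ℝ))) ⁻¹' C k) := by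
        refine measure_mono fun y hy => ?_
        obtain ⟨hy, k, hk⟩ := hy
        refine Set.mem_iUnion.2 ⟨k, fun i => by simpa using hy i, ?_⟩
        beta_reduce
        rwa [mem_closedBall_iff_norm, ← sub_eq_add_neg, sub_right_comm]
    _ ≤ ∑' k, volume ((· + -(WithLp.toLp 2 fun i => (k i : ℝ))) ⁻¹' C k) := measure_iUnion_le _
    _ = ∑' k, volume (C k) := by simp only [measure_preimage_add_right]
    _ = volume (⋃ k, C k) := (measure_iUnion hdisj hCmeas).symm
    _ ≤ volume (Metric.closedBall z r) :=
        measure_mono (Set.iUnion_subset fun k => Set.inter_subset_right)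
    _ = _ := by rw [Measure.addHaar_closedBall _ _ hr, finrank_euclideanSpace_fin, mul_comm]

/-- Configurations all of whose points lie within torus distance `r` of their parent's point. -/
lemma volume_forest_le {ι : Type*} [Fintype ι] [DecidableEq ι] (d : ℕ) {r : ℝ} (hr : 0 ≤ r)
    {p : ι → ι} {o : ι} (hp : p ∈ forestMaps Finset.univ {o}) :
    volume {X : ι → EuclideanSpace ℝ (Fin d) | (∀ v i, 0 ≤ X v i ∧ X v i < 1) ∧
      ∀ v, v ≠ o → ∃ k : Fin d → ℤ,
        ‖X v - X (p v) - WithLp.toLp 2 (fun i => (k i : ℝ))‖ ≤ r} ≤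
      (volume (Metric.ball (0 : EuclideanSpace ℝ (Fin d)) 1) * ENNReal.ofReal (r ^ d)) ^
        (Fintype.card ι - 1) := by
  classical
  obtain ⟨-, -, h, hh⟩ := mem_forestMaps.1 hp
  replace hh : ∀ v, v ≠ o → h (p v) < h v := fun v hv => hh v (by simpa using hv)
  let A : ι → Set (ι → EuclideanSpace ℝ (Fin d)) := fun v =>
    {X | (∀ i, 0 ≤ X v i ∧ X v i < 1) ∧ (v ≠ o → ∃ k : Fin d → ℤ,
      ‖X v - X (p v) - WithLp.toLp 2 (fun i => (k i : ℝ))‖ ≤ r)}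
  set b := volume (Metric.ball (0 : EuclideanSpace ℝ (Fin d)) 1) * ENNReal.ofReal (r ^ d)
  have hA : ∀ v, MeasurableSet (A v) := fun v => by
    refine ((measurableSet_unitCube d).preimage (measurable_pi_apply v)).inter ?_
    refine (Measurable.imp measurable_const (Measurable.exists fun k => ?_)).setOf
    exact measurableSet_setOfPred.1 (measurableSet_le (by fun_prop) measurable_const)
  have hset : {X : ι → EuclideanSpace ℝ (Fin d) | (∀ v i, 0 ≤ X v i ∧ X v i < 1) ∧
      ∀ v, v ≠ o → ∃ k : Fin d → ℤ,
        ‖X v - X (p v) - WithLp.toLp 2 (fun i => (k i : ℝ))‖ ≤ r} = ⋂ v, A v := by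
    ext X
    simp [A, forall_and]
  have hprod : (⋂ v, A v).indicator (1 : (ι → EuclideanSpace ℝ (Fin d)) → ENNReal) =
      fun X => ∏ v, (A v).indicator 1 X := by
    funext X
    by_cases hX : X ∈ ⋂ v, A v
    · rw [Set.indicator_of_mem hX]
      simp [Set.mem_iInter.1 hX]
    · rw [Set.indicator_of_notMem hX]
      obtain ⟨v, hv⟩ := not_forall.1 (Set.mem_iInter.not.1 hX)
      exact (Finset.prod_eq_zero (Finset.mem_univ v) (by simp [hv])).symm
  have hc : ∏ v, (if v = o then 1 else b) = b ^ (Fintype.card ι - 1) := by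
    rw [← Finset.mul_prod_erase _ _ (Finset.mem_univ o),
      Finset.prod_congr rfl fun v hv => if_neg (Finset.ne_of_mem_erase hv)]
    simp
  have hdep : ∀ v w, h w ≤ h v → w ≠ v → ∀ (x : ι → EuclideanSpace ℝ (Fin d)) y,
      (A w).indicator (1 : (ι → EuclideanSpace ℝ (Fin d)) → ENNReal)
        (Function.update x v y) = (A w).indicator 1 x := by
    intro v w hwv hne x y
    have : Function.update x v y ∈ A w ↔ x ∈ A w := by
      by_cases hw : w = o
      · simp [A, hw, Function.update_of_ne (hw ▸ hne)]
      · have hpv : p w ≠ v := fun e => absurd (hh w hw) (by rw [e]; exact hwv.not_gt)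
        simp [A, Function.update_of_ne hne, Function.update_of_ne hpv]
    simp only [Set.indicator_apply, this]
    rfl
  have hint : ∀ v (x : ι → EuclideanSpace ℝ (Fin d)),
      ∫⁻ y, (A v).indicator (1 : (ι → EuclideanSpace ℝ (Fin d)) → ENNReal)
        (Function.update x v y) ≤ if v = o then 1 else b := by
    intro v x
    change ∫⁻ y, (Function.update x v ⁻¹' A v).indicator 1 y ≤ _
    rw [lintegral_indicator_one ((hA v).preimage (measurable_update x))]
    split_ifs with hv
    · refine le_trans (measure_mono fun y hy => ?_) (volume_unitCube_le_one d)
      simpa using hy.1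
    · refine le_trans (measure_mono fun y hy => ?_) (volume_torusBall_le d (x (p v)) hr)
      have hpv : p v ≠ v := fun e => absurd (hh v hv) (by rw [e]; exact lt_irrefl _)
      have h1 := hy.1
      have h2 := hy.2 hv
      simp only [Function.update_self, Function.update_of_ne hpv] at h1 h2
      exact ⟨h1, h2⟩
  rw [hset, ← lintegral_indicator_one (MeasurableSet.iInter hA), hprod, ← hc, volume_pi,
    lintegral_eq_lmarginal_univ 0]
  exact lmarginal_prod_le h (fun v => measurable_one.indicator (hA v)) hdep hint Finset.univ 0

/-- Measure of configurations whose `r`-proximity graph is connected: on the torus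
`𝕋^d` (represented by the fundamental domain `[0,1)^d`, with quotient distance
`dist_{𝕋^d}(a,b) ≤ r ↔ ∃ k ∈ ℤ^d, ‖a − b − k‖ ≤ r`), the measure of the set of
`n`-tuples whose proximity graph at scale `r` is connected is at most
`n^{n−2} (ω_d r^d)^{n−1}`, `ω_d` being the volume of the unit ball of `ℝ^d`. -/
theorem stmt_6 (d n : ℕ) (hd : 1 ≤ d) (hn : 2 ≤ n) (r : ℝ) (hr : 0 < r) :
    volume
        {X : Fin n → EuclideanSpace ℝ (Fin d) |
          (∀ a, ∀ i, 0 ≤ X a i ∧ X a i < 1) ∧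
          (SimpleGraph.fromRel fun a b =>
              ∃ k : Fin d → ℤ,
                ‖X a - X b - (WithLp.equiv 2 (Fin d → ℝ)).symm (fun i => (k i : ℝ))‖
                  ≤ r).Connected}
      ≤ (n : ENNReal) ^ (n - 2) *
          (volume (Metric.ball (0 : EuclideanSpace ℝ (Fin d)) 1) *
            ENNReal.ofReal (r ^ d)) ^ (n - 1) := by
  set b := volume (Metric.ball (0 : EuclideanSpace ℝ (Fin d)) 1) * ENNReal.ofReal (r ^ d)
  let o : Fin n := ⟨0, by omega⟩
  have hcard : (forestMaps (Finset.univ : Finset (Fin n)) {o}).card ≤ n ^ (n - 2) := by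
    have := card_forestMaps_mul_card_le (Finset.subset_univ ({o} : Finset (Fin n)))
    simp only [Finset.card_univ, Fintype.card_fin, Finset.card_singleton, one_mul] at this
    rw [show n - 1 = n - 2 + 1 by omega, pow_succ] at this
    exact Nat.le_of_mul_le_mul_right this (by omega)
  calc _ ≤ volume (⋃ p ∈ forestMaps (Finset.univ : Finset (Fin n)) {o},
        {X : Fin n → EuclideanSpace ℝ (Fin d) | (∀ v i, 0 ≤ X v i ∧ X v i < 1) ∧
          ∀ v, v ≠ o → ∃ k : Fin d → ℤ,
            ‖X v - X (p v) - WithLp.toLp 2 (fun i => (k i : ℝ))‖ ≤ r}) := by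
        refine measure_mono fun X hX => ?_
        obtain ⟨hcube, hconn⟩ := hX
        obtain ⟨p, hp, hadj⟩ := hconn.exists_mem_forestMaps o
        refine Set.mem_biUnion hp ⟨hcube, fun v hv => ?_⟩
        obtain ⟨-, hk | ⟨k, hk⟩⟩ := (SimpleGraph.fromRel_adj _ _ _).1 (hadj v hv)
        · exact hk
        · refine ⟨-k, ?_⟩
          rw [← norm_neg] at hk
          convert hk using 1
          congr 1
          ext i
          simp
          ring
    _ ≤ ∑ p ∈ forestMaps (Finset.univ : Finset (Fin n)) {o}, b ^ (n - 1) := by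
        refine (measure_biUnion_finset_le _ _).trans (Finset.sum_le_sum fun p hp => ?_)
        simpa using volume_forest_le d hr.le hp
    _ ≤ _ := by
        rw [Finset.sum_const, nsmul_eq_mul]
        gcongr
        exact_mod_cast hcard
end

section
/- Let d ≥ 2. For every constant C_0 > 0 there exist ε_0 ∈ (0,1) and C̃ > 0, depending only on d and C_0, with the following property. Let 0 < ε < ε_0, μ_ε = ε^{−(d−1)}, let N ≥ 1, ρ_0 > 0, and let Φ_N : 𝔻^N → ℝ be a symmetric measurable function satisfying sup_{x_N ∈ 𝕋^d} ∫ |Φ_N(Z_N)| M^{⊗N}(V_N) dX_{N−1} dV_N ≤ C_0^N ρ_0 (the integral being over the first N−1 positions and all N velocities, for every fixed value of the last position x_N). Then the series E_ε(Φ_N) := (1/Z^ε) ∑_{p≥0} (μ_ε^p/p!) ∫_{𝔻^{N+p}} 1_{D^ε_{N+p}}(Z_{N+p}) M^{⊗(N+p)}(V_{N+p}) Φ_N(Z_N) dZ_{N+p} converges absolutely and satisfies |E_ε(Φ_N)| ≤ C̃^N ρ_0. -/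
open MeasureTheory Real
open scoped ENNReal BigOperators Classical

noncomputable section

/-- The unit `d`-dimensional torus `𝕋^d = ℝ^d/ℤ^d`, as a product of unit circles.
It carries its Haar probability measure. -/
abbrev Torus (d : ℕ) := Fin d → AddCircle (1 : ℝ)

/-- The Euclidean quotient distance on the torus `𝕋^d`. -/
noncomputable def torusDist {d : ℕ} (x y : Torus d) : ℝ :=
  Real.sqrt (∑ i, dist (x i) (y i) ^ 2)

/-- The one-particle phase space `𝔻 = 𝕋^d × ℝ^d`. -/
abbrev Phase (d : ℕ) := Torus d × EuclideanSpace ℝ (Fin d)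

/-- The standard Maxwellian `M(v) = (2π)^{−d/2} exp(−|v|²/2)`. -/
noncomputable def maxwellian (d : ℕ) (v : EuclideanSpace ℝ (Fin d)) : ℝ :=
  (2 * π) ^ (-(d : ℝ) / 2) * Real.exp (-‖v‖ ^ 2 / 2)

/-- The Boltzmann-Grad density `μ_ε = ε^{−(d−1)}`. -/
noncomputable def mu (d : ℕ) (ε : ℝ) : ℝ := ε ^ (-((d : ℤ) - 1))

/-- The hard-core exclusion: `Z_N ∈ D^ε_N` iff all mutual torus distances of the
positions exceed `ε`. -/
def HardCore (d : ℕ) (ε : ℝ) {N : ℕ} (Z : Fin N → Phase d) : Prop :=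
  ∀ i j, i ≠ j → ε < torusDist (Z i).1 (Z j).1

/-- The density `1_{D^ε_N}(Z_N) M^{⊗N}(V_N)` of the hard-sphere Gibbs weight. -/
noncomputable def hsWeight (d : ℕ) (ε : ℝ) {N : ℕ} (Z : Fin N → Phase d) : ℝ :=
  (if HardCore d ε Z then 1 else 0) * ∏ i, maxwellian d (Z i).2

/-- The grand canonical partition function
`Z^ε = 1 + ∑_{N≥1} (μ_ε^N/N!) ∫ 1_{D^ε_N} M^{⊗N} dZ_N` (the `N = 0` term of the
series equals `1`). -/
noncomputable def partitionFn (d : ℕ) (ε : ℝ) : ℝ :=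
  ∑' N : ℕ, mu d ε ^ N / N.factorial * ∫ Z : Fin N → Phase d, hsWeight d ε Z

/-- The `N`-fold measure on `𝔻^N` in which the position of the last particle is frozen
at `x` (Dirac mass) while all other positions and all velocities carry their Haar /
Lebesgue measures; it realizes the integration `dX_{N−1} dV_N` at fixed `x_N = x`. -/
noncomputable def lastFixed (d N : ℕ) (x : Torus d) : Measure (Fin N → Phase d) :=
  Measure.pi fun i =>
    if (i : ℕ) = N - 1 then (Measure.dirac x).prod (volume : Measure (EuclideanSpace ℝ (Fin d)))
    else (volume : Measure (Phase d))

instance isProbabilityMeasure_volume_addCircle_one :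
    IsProbabilityMeasure (volume : Measure (AddCircle (1 : ℝ))) :=
  ⟨by rw [AddCircle.measure_univ, ENNReal.ofReal_one]⟩

instance isProbabilityMeasure_volume_torus (d : ℕ) :
    IsProbabilityMeasure (volume : Measure (Torus d)) := by
  rw [volume_pi]; infer_instance

instance sigmaFinite_volume_phase (d : ℕ) : SigmaFinite (volume : Measure (Phase d)) := by
  rw [Measure.volume_eq_prod]; infer_instance

theorem maxwellian_nonneg (d : ℕ) (v : EuclideanSpace ℝ (Fin d)) : 0 ≤ maxwellian d v := by
  unfold maxwellian; positivity

theorem measurable_maxwellian (d : ℕ) : Measurable (maxwellian d) := by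
  unfold maxwellian; fun_prop

theorem integral_maxwellian (d : ℕ) : ∫ v, maxwellian d v = 1 := by
  have h := GaussianFourier.integral_rexp_neg_mul_sq_norm
    (V := EuclideanSpace ℝ (Fin d)) (b := 1 / 2) (by norm_num)
  have h2 : ∀ v : EuclideanSpace ℝ (Fin d), maxwellian d v =
      (2 * π) ^ (-(d : ℝ) / 2) * rexp (-(1 / 2) * ‖v‖ ^ 2) := fun v => by
    simp only [maxwellian]; ring_nf
  simp_rw [h2]
  rw [integral_const_mul, h, finrank_euclideanSpace_fin, show π / (1 / 2) = 2 * π by ring,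
    ← Real.rpow_add (by positivity), show -(d : ℝ) / 2 + d / 2 = 0 by ring, Real.rpow_zero]

theorem integral_maxwellian_snd (d : ℕ) : ∫ z : Phase d, maxwellian d z.2 = 1 := by
  have h := integral_prod_mul (μ := (volume : Measure (Torus d)))
    (ν := (volume : Measure (EuclideanSpace ℝ (Fin d)))) (fun _ => (1 : ℝ)) (maxwellian d)
  simpa [integral_maxwellian, Measure.volume_eq_prod] using h

theorem integral_prod_maxwellian (d n : ℕ) :
    ∫ Z : Fin n → Phase d, ∏ i, maxwellian d (Z i).2 = 1 := by
  have h := integral_fintype_prod_volume_eq_prod (ι := Fin n) (E := fun _ => Phase d)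
    (fun _ z => maxwellian d z.2)
  simpa only [integral_maxwellian_snd, Finset.prod_const_one] using h

theorem integrable_prod_maxwellian (d n : ℕ) :
    Integrable (fun Z : Fin n → Phase d => ∏ i, maxwellian d (Z i).2) :=
  .of_integral_ne_zero (by rw [integral_prod_maxwellian]; exact one_ne_zero)

theorem measurableSet_hardCore (d : ℕ) (ε : ℝ) (n : ℕ) :
    MeasurableSet {Z : Fin n → Phase d | HardCore d ε Z} := by
  simp only [HardCore, Set.ofPred_forall]
  refine .iInter fun i => .iInter fun j => .iInter fun _ => ?_
  refine measurableSet_lt measurable_const (Continuous.measurable ?_)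
  unfold torusDist
  fun_prop

theorem measurable_hsWeight (d : ℕ) (ε : ℝ) (n : ℕ) :
    Measurable (fun Z : Fin n → Phase d => hsWeight d ε Z) := by
  have hM := measurable_maxwellian d
  refine (Measurable.ite (measurableSet_hardCore d ε n) measurable_const measurable_const).mul ?_
  fun_prop

theorem hsWeight_nonneg (d : ℕ) (ε : ℝ) {n : ℕ} (Z : Fin n → Phase d) : 0 ≤ hsWeight d ε Z :=
  mul_nonneg (by split_ifs <;> norm_num) (Finset.prod_nonneg fun _ _ => maxwellian_nonneg d _)

theorem hsWeight_le (d : ℕ) (ε : ℝ) {n : ℕ} (Z : Fin n → Phase d) :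
    hsWeight d ε Z ≤ ∏ i, maxwellian d (Z i).2 :=
  mul_le_of_le_one_left (Finset.prod_nonneg fun _ _ => maxwellian_nonneg d _)
    (by split_ifs <;> norm_num)

theorem integrable_hsWeight (d : ℕ) (ε : ℝ) (n : ℕ) :
    Integrable (fun Z : Fin n → Phase d => hsWeight d ε Z) :=
  (integrable_prod_maxwellian d n).mono' (measurable_hsWeight d ε n).aestronglyMeasurable
    (.of_forall fun Z => by
      rw [Real.norm_of_nonneg (hsWeight_nonneg d ε Z)]; exact hsWeight_le d ε Z)

theorem integral_hsWeight_nonneg (d : ℕ) (ε : ℝ) (n : ℕ) :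
    0 ≤ ∫ Z : Fin n → Phase d, hsWeight d ε Z :=
  integral_nonneg fun Z => hsWeight_nonneg d ε Z

theorem integral_hsWeight_le_one (d : ℕ) (ε : ℝ) (n : ℕ) :
    ∫ Z : Fin n → Phase d, hsWeight d ε Z ≤ 1 :=
  (integral_mono (integrable_hsWeight d ε n) (integrable_prod_maxwellian d n)
    fun Z => hsWeight_le d ε Z).trans_eq (integral_prod_maxwellian d n)

/-- Dropping the exclusion between two groups of particles decouples their weights. -/
theorem hsWeight_add_le (d : ℕ) (ε : ℝ) {n p : ℕ} (Z : Fin (n + p) → Phase d) :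
    hsWeight d ε Z ≤
      (∏ i : Fin n, maxwellian d (Z (Fin.castAdd p i)).2) * hsWeight d ε (Z ∘ Fin.natAdd n) := by
  have h1 : 0 ≤ ∏ i : Fin n, maxwellian d (Z (Fin.castAdd p i)).2 :=
    Finset.prod_nonneg fun _ _ => maxwellian_nonneg d _
  by_cases h : HardCore d ε Z
  · have h' : HardCore d ε (Z ∘ Fin.natAdd n) := fun i j hij =>
      h _ _ fun hh => hij (Fin.natAdd_injective p n hh)
    simp only [hsWeight, if_pos h, if_pos h', one_mul, Fin.prod_univ_add, Function.comp]
    exact le_rfl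
  · simp only [hsWeight, if_neg h, zero_mul]
    exact mul_nonneg h1 (hsWeight_nonneg d ε (Z ∘ Fin.natAdd n))

/-- Splitting `n + p` variables into the first `n` and the last `p`. -/
def finAppendSplit (α : Type*) [MeasurableSpace α] (n p : ℕ) :
    (Fin (n + p) → α) ≃ᵐ (Fin n → α) × (Fin p → α) :=
  (MeasurableEquiv.piCongrLeft (fun _ => α) finSumFinEquiv).symm.trans
    (MeasurableEquiv.sumPiEquivProdPi fun _ => α)

theorem finAppendSplit_apply (α : Type*) [MeasurableSpace α] (n p : ℕ) (Z : Fin (n + p) → α) :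
    finAppendSplit α n p Z = (Z ∘ Fin.castAdd p, Z ∘ Fin.natAdd n) := rfl

theorem measurePreserving_finAppendSplit (α : Type*) [MeasureSpace α]
    [SigmaFinite (volume : Measure α)] (n p : ℕ) :
    MeasurePreserving (finAppendSplit α n p) :=
  ((volume_measurePreserving_piCongrLeft (fun _ => α) finSumFinEquiv).symm _).trans
    (volume_measurePreserving_sumPiEquivProdPi fun _ => α)

/-- Disintegration of the volume on `𝔻^N` over the position of the last particle. -/
theorem lintegral_lastFixed (d n : ℕ) {F : (Fin (n + 1) → Phase d) → ℝ≥0∞} (hF : Measurable F) :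
    ∫⁻ x, ∫⁻ Z, F Z ∂(lastFixed d (n + 1) x) = ∫⁻ Z, F Z := by
  set e := MeasurableEquiv.piFinSuccAbove (fun _ : Fin (n + 1) => Phase d) (Fin.last n)
  have hFe : Measurable (F ∘ e.symm) := hF.comp e.symm.measurable
  have hFeq : ∀ Z, F Z = (F ∘ e.symm) (e Z) := fun Z => by simp
  have hfix : ∀ x, ∫⁻ Z, F Z ∂(lastFixed d (n + 1) x) =
      ∫⁻ v, ∫⁻ Y, (F ∘ e.symm) ((x, v), Y) := by
    intro x
    let m : Fin (n + 1) → Measure (Phase d) := fun i =>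
      if (i : ℕ) = n + 1 - 1 then
        (Measure.dirac x).prod (volume : Measure (EuclideanSpace ℝ (Fin d)))
      else volume
    have : ∀ i, SigmaFinite (m i) := fun i => by
      dsimp only [m]; split_ifs <;> infer_instance
    have hm := measurePreserving_piFinSuccAbove m (Fin.last n)
    have hlast : m (Fin.last n) = (Measure.dirac x).prod volume := by simp [m]
    have hrest : (fun j => m ((Fin.last n).succAbove j)) = fun _ => volume := by
      funext j
      simp [m, j.isLt.ne]
    have h1 : ∫⁻ Z, F Z ∂(lastFixed d (n + 1) x) = ∫⁻ Z, (F ∘ e.symm) (e Z) ∂(Measure.pi m) :=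
      lintegral_congr hFeq
    rw [h1, hm.lintegral_comp hFe, lintegral_prod _ hFe.aemeasurable, hlast, hrest,
      lintegral_prod _ (Measurable.lintegral_prod_right' hFe).aemeasurable,
      lintegral_dirac' _ (Measurable.lintegral_prod_right'
        (Measurable.lintegral_prod_right' hFe))]
    rfl
  have hvol : ∫⁻ Z, F Z = ∫⁻ y : Phase d, ∫⁻ Y, (F ∘ e.symm) (y, Y) := by
    rw [lintegral_congr hFeq,
      (volume_preserving_piFinSuccAbove (fun _ => Phase d) (Fin.last n)).lintegral_comp hFe]
    exact lintegral_prod _ hFe.aemeasurable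
  rw [hvol, lintegral_congr hfix]
  exact (lintegral_prod _ (Measurable.lintegral_prod_right' hFe).aemeasurable).symm

/-- A bound uniform in the position of the last particle gives a bound on the full integral. -/
theorem lintegral_le_of_lastFixed_le {d N : ℕ} (hN : 1 ≤ N) {F : (Fin N → Phase d) → ℝ≥0∞}
    (hF : Measurable F) {K : ℝ≥0∞} (h : ∀ x, ∫⁻ Z, F Z ∂(lastFixed d N x) ≤ K) :
    ∫⁻ Z, F Z ≤ K := by
  obtain ⟨n, rfl⟩ : ∃ n, N = n + 1 := ⟨N - 1, by omega⟩
  rw [← lintegral_lastFixed d n hF]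
  exact (lintegral_mono h).trans (by simp)

/-- The contribution of `p` background particles is bounded by the `p`-particle weight. -/
theorem abs_integral_hsWeight_mul_le {d N : ℕ} (ε : ℝ) (p : ℕ) {Φ : (Fin N → Phase d) → ℝ}
    (hF : Integrable fun Z : Fin N → Phase d => |Φ Z| * ∏ i, maxwellian d (Z i).2) :
    |∫ Z : Fin (N + p) → Phase d, hsWeight d ε Z * Φ (Z ∘ Fin.castAdd p)| ≤
      (∫ Z : Fin N → Phase d, |Φ Z| * ∏ i, maxwellian d (Z i).2) *
        ∫ Z : Fin p → Phase d, hsWeight d ε Z := by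
  have hmp := measurePreserving_finAppendSplit (Phase d) N p
  rw [← integral_prod_mul, ← Measure.volume_eq_prod,
    ← hmp.integral_comp (finAppendSplit (Phase d) N p).measurableEmbedding, ← Real.norm_eq_abs]
  refine norm_integral_le_of_norm_le ?_ (.of_forall fun Z => ?_)
  · exact (hmp.integrable_comp_emb (finAppendSplit (Phase d) N p).measurableEmbedding).2
      (hF.mul_prod (integrable_hsWeight d ε p))
  · rw [norm_mul, Real.norm_of_nonneg (hsWeight_nonneg d ε Z), Real.norm_eq_abs,
      finAppendSplit_apply]
    refine (mul_le_mul_of_nonneg_right (hsWeight_add_le d ε Z) (abs_nonneg _)).trans_eq ?_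
    simp only [Function.comp_apply]
    ring

theorem mu_nonneg (d : ℕ) {ε : ℝ} (hε : 0 < ε) : 0 ≤ mu d ε := by
  unfold mu; positivity

theorem summable_partitionFn (d : ℕ) {ε : ℝ} (hε : 0 < ε) :
    Summable fun p : ℕ => mu d ε ^ p / p.factorial * ∫ Z : Fin p → Phase d, hsWeight d ε Z := by
  have hmu := mu_nonneg d hε
  refine Summable.of_nonneg_of_le
    (fun p => mul_nonneg (by positivity) (integral_hsWeight_nonneg d ε p))
    (fun p => mul_le_of_le_one_right (by positivity) (integral_hsWeight_le_one d ε p))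
    (Real.summable_pow_div_factorial (mu d ε))

theorem partitionFn_nonneg (d : ℕ) {ε : ℝ} (hε : 0 < ε) : 0 ≤ partitionFn d ε := by
  have hmu := mu_nonneg d hε
  exact tsum_nonneg fun p => mul_nonneg (by positivity) (integral_hsWeight_nonneg d ε p)

/-- First conclusion (3.4) of Proposition 3.1: if the symmetric function `Φ_N`
satisfies `sup_{x_N} ∫ |Φ_N| M^{⊗N} dX_{N−1} dV_N ≤ C₀^N ρ₀`, then the series defining
the grand canonical expectation `E_ε(Φ_N)` converges absolutely and
`|E_ε(Φ_N)| ≤ C̃^N ρ₀`, where `ε₀` and `C̃` depend only on `d` and `C₀`. -/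
theorem stmt_7 (d : ℕ) (hd : 2 ≤ d) (C₀ : ℝ) (hC₀ : 0 < C₀) :
    ∃ ε₀ ∈ Set.Ioo (0 : ℝ) 1, ∃ C' : ℝ, 0 < C' ∧
      ∀ ε : ℝ, 0 < ε → ε < ε₀ →
      ∀ N : ℕ, 1 ≤ N →
      ∀ ρ₀ : ℝ, 0 < ρ₀ →
      ∀ Φ : (Fin N → Phase d) → ℝ, Measurable Φ →
        (∀ σ : Equiv.Perm (Fin N), ∀ Z, Φ (Z ∘ σ) = Φ Z) →
        (∀ x : Torus d,
          ∫⁻ Z, ENNReal.ofReal (|Φ Z| * ∏ i, maxwellian d (Z i).2) ∂(lastFixed d N x)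
            ≤ ENNReal.ofReal (C₀ ^ N * ρ₀)) →
        Summable (fun p : ℕ =>
            |mu d ε ^ p / p.factorial *
              ∫ Z : Fin (N + p) → Phase d, hsWeight d ε Z * Φ (Z ∘ Fin.castAdd p)|) ∧
        |(partitionFn d ε)⁻¹ *
            ∑' p : ℕ, mu d ε ^ p / p.factorial *
              ∫ Z : Fin (N + p) → Phase d, hsWeight d ε Z * Φ (Z ∘ Fin.castAdd p)|
          ≤ C' ^ N * ρ₀ := by
  refine ⟨1 / 2, by norm_num, C₀, hC₀, ?_⟩
  intro ε hε _ N hN ρ₀ hρ₀ Φ hΦ _ hbound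
  have hK : 0 ≤ C₀ ^ N * ρ₀ := by positivity
  have hM := measurable_maxwellian d
  have hmeas : Measurable fun Z : Fin N → Phase d => |Φ Z| * ∏ i, maxwellian d (Z i).2 := by
    fun_prop
  have hnn : ∀ Z : Fin N → Phase d, 0 ≤ |Φ Z| * ∏ i, maxwellian d (Z i).2 := fun Z =>
    mul_nonneg (abs_nonneg _) (Finset.prod_nonneg fun _ _ => maxwellian_nonneg d _)
  have hlint := lintegral_le_of_lastFixed_le hN hmeas.ennreal_ofReal hbound
  have hint : Integrable fun Z : Fin N → Phase d => |Φ Z| * ∏ i, maxwellian d (Z i).2 :=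
    ⟨hmeas.aestronglyMeasurable, (hasFiniteIntegral_iff_ofReal (.of_forall hnn)).2
      (hlint.trans_lt ENNReal.ofReal_lt_top)⟩
  have hle : ∫ Z : Fin N → Phase d, |Φ Z| * ∏ i, maxwellian d (Z i).2 ≤ C₀ ^ N * ρ₀ := by
    rw [integral_eq_lintegral_of_nonneg_ae (.of_forall hnn) hmeas.aestronglyMeasurable]
    exact ENNReal.toReal_le_of_le_ofReal hK hlint
  have hmu := mu_nonneg d hε
  have hterm : ∀ p : ℕ, |mu d ε ^ p / p.factorial *
      ∫ Z : Fin (N + p) → Phase d, hsWeight d ε Z * Φ (Z ∘ Fin.castAdd p)| ≤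
      C₀ ^ N * ρ₀ * (mu d ε ^ p / p.factorial * ∫ Z : Fin p → Phase d, hsWeight d ε Z) := by
    intro p
    have hc : 0 ≤ mu d ε ^ p / p.factorial := by positivity
    rw [abs_mul, abs_of_nonneg hc, mul_left_comm]
    exact mul_le_mul_of_nonneg_left ((abs_integral_hsWeight_mul_le ε p hint).trans
      (mul_le_mul_of_nonneg_right hle (integral_hsWeight_nonneg d ε p))) hc
  have hsum := (summable_partitionFn d hε).mul_left (C₀ ^ N * ρ₀)
  refine ⟨hsum.of_nonneg_of_le (fun _ => abs_nonneg _) hterm, ?_⟩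
  have htsum := tsum_of_norm_bounded hsum.hasSum fun p =>
    (Real.norm_eq_abs _).trans_le (hterm p)
  rw [tsum_mul_left, Real.norm_eq_abs] at htsum
  have hZ := partitionFn_nonneg d hε
  rw [abs_mul, abs_of_nonneg (inv_nonneg.2 hZ)]
  refine inv_mul_le_of_le_mul₀ hZ hK ?_
  rw [mul_comm]
  exact htsum
end
end
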